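/- arXiv:0811.3133 — 4 statements merged into one kernel-verified Lean document; each statement's English description precedes it below -/
import Mathlib

section
/- Let n ≥ 1, let K ⊆ ℝⁿ be a compact set, and let f : ℝⁿ → ℝⁿ be continuous and injective with f(x) = x for all x ∉ K. Then f is surjective, and f is a homeomorphism of ℝⁿ onto itself (i.e., f is bijective and its inverse is continuous). -/
open MeasureTheory Metric Module Set Filter Topology Polynomial
open scoped NNReal Manifold ContDiff

section Polynomial

theorem Polynomial.exists_eval_one_eq_sum (d : ℕ) {δ : ℝ} (hδ : 0 < δ) :
    ∃ v w : Fin (d + 1) → ℝ, (∀ i, 0 < v i ∧ v i < δ) ∧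
      ∀ p : ℝ[X], p.natDegree ≤ d → p.eval 1 = ∑ i, w i * p.eval (v i) := by
  let v : Fin (d + 1) → ℝ := fun i ↦ δ / ((i : ℕ) + 2)
  have hv : Function.Injective v := by
    intro i j hij
    have hi : ((i : ℕ) : ℝ) + 2 ≠ 0 := by positivity
    have hj : ((j : ℕ) : ℝ) + 2 ≠ 0 := by positivity
    simp only [v] at hij
    rw [div_eq_div_iff hi hj] at hij
    have := mul_left_cancel₀ hδ.ne' hij
    exact Fin.ext (by exact_mod_cast (add_right_cancel this).symm)
  refine ⟨v, fun i ↦ (Lagrange.basis Finset.univ v i).eval 1, fun i ↦ ⟨by positivity, ?_⟩, ?_⟩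
  · exact div_lt_self hδ (by linarith [(Nat.cast_nonneg (i : ℕ) : (0 : ℝ) ≤ _)])
  · intro p hp
    have hdeg : p.degree < (Finset.univ : Finset (Fin (d + 1))).card := by
      rw [Finset.card_univ, Fintype.card_fin]
      exact (degree_le_of_natDegree_le hp).trans_lt (by exact_mod_cast d.lt_succ_self)
    conv_lhs => rw [Lagrange.eq_interpolate hv.injOn hdeg]
    simp [Lagrange.interpolate_apply, eval_finsetSum, mul_comm]

end Polynomial

section Determinant

variable {E : Type*} [NormedAddCommGroup E] [NormedSpace ℝ E]

theorem ContinuousLinearMap.exists_polynomial_det_one_add_smul [FiniteDimensional ℝ E]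
    (A : E →L[ℝ] E) :
    ∃ p : ℝ[X], p.natDegree ≤ finrank ℝ E ∧ ∀ t : ℝ, p.eval t = (1 + t • A).det := by
  let b := finBasis ℝ E
  let M := LinearMap.toMatrix b b (A : E →ₗ[ℝ] E)
  refine ⟨((X : ℝ[X]) • M.map C + (1 : Matrix _ _ ℝ).map C).det,
    by simpa using natDegree_det_X_add_C_le M 1, fun t ↦ ?_⟩
  have h1 : (1 + t • A).det = (1 + t • M).det := by
    rw [ContinuousLinearMap.det, ← LinearMap.det_toMatrix b]
    congr 1
    simp [M]
  rw [h1, ← coe_evalRingHom, RingHom.map_det]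
  congr 1
  ext i j
  by_cases hij : i = j
  · subst hij
    simp [add_comm, mul_comm t]
  · simp [hij, mul_comm t]

theorem ContinuousLinearMap.exists_forall_norm_lt_det_one_add_pos :
    ∃ δ : ℝ, 0 < δ ∧ ∀ A : E →L[ℝ] E, ‖A‖ < δ → 0 < (1 + A).det := by
  have hc : Continuous fun A : E →L[ℝ] E ↦ (1 + A).det :=
    ContinuousLinearMap.continuous_det.comp (continuous_const.add continuous_id)
  have h0 : (0 : ℝ) < (1 + (0 : E →L[ℝ] E)).det := by
    simp [ContinuousLinearMap.det]
  obtain ⟨δ, hδ, h⟩ := Metric.eventually_nhds_iff.1 (hc.continuousAt.eventually (lt_mem_nhds h0))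
  exact ⟨δ, hδ, fun A hA ↦ h (by simpa using hA)⟩

end Determinant

section Lipschitz

variable {E F : Type*} [NormedAddCommGroup E] [NormedSpace ℝ E] [NormedAddCommGroup F]

/-- Extending by zero a Lipschitz map on a ball vanishing on the sphere gives a Lipschitz map. -/
theorem LipschitzOnWith.indicator_closedBall {g : E → F} {R : ℝ} {C : ℝ≥0}
    (hg : LipschitzOnWith C g (closedBall 0 R)) (h0 : ∀ x ∈ sphere (0 : E) R, g x = 0) :
    LipschitzWith C ((closedBall (0 : E) R).indicator g) := by
  have key : ∀ x ∈ closedBall (0 : E) R, ∀ y ∉ closedBall (0 : E) R, ‖g x‖ ≤ C * ‖x - y‖ := by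
    intro x hx y hy
    have hxR : ‖x‖ ≤ R := by simpa using hx
    have hyR : R < ‖y‖ := by simpa using hy
    obtain ⟨t, ht, htR⟩ : ∃ t ∈ Icc (0 : ℝ) 1, ‖AffineMap.lineMap x y t‖ = R := by
      apply intermediate_value_Icc zero_le_one
        (f := fun t : ℝ ↦ ‖(AffineMap.lineMap x y t : E)‖)
      · exact (AffineMap.lineMap_continuous.norm).continuousOn
      · simp [hxR, hyR.le]
    have hz : AffineMap.lineMap x y t ∈ sphere (0 : E) R := by simpa using htR
    have h := hg.norm_sub_le hx (sphere_subset_closedBall hz)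
    rw [h0 _ hz, sub_zero] at h
    refine h.trans (mul_le_mul_of_nonneg_left ?_ C.2)
    rw [← dist_eq_norm, dist_left_lineMap, ← dist_eq_norm, Real.norm_of_nonneg ht.1]
    exact mul_le_of_le_one_left dist_nonneg ht.2
  refine LipschitzWith.of_dist_le_mul fun x y ↦ ?_
  rw [dist_eq_norm, dist_eq_norm]
  by_cases hx : x ∈ closedBall (0 : E) R <;> by_cases hy : y ∈ closedBall (0 : E) R
  · simpa only [indicator_of_mem hx, indicator_of_mem hy] using hg.norm_sub_le hx hy
  · simpa only [indicator_of_mem hx, indicator_of_notMem hy, sub_zero] using key x hx y hy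
  · simpa only [indicator_of_notMem hx, indicator_of_mem hy, zero_sub, norm_neg,
      norm_sub_rev x y] using key y hy x hx
  · simp only [indicator_of_notMem hx, indicator_of_notMem hy, sub_zero, norm_zero]
    positivity

/-- Perturbing the identity by a contraction gives a bijection. -/
theorem LipschitzWith.bijective_id_add [CompleteSpace E] {g : E → E} {c : ℝ≥0}
    (hg : LipschitzWith c g) (hc : c < 1) : Function.Bijective fun x ↦ x + g x := by
  have happ : ApproximatesLinearOn (fun x ↦ x + g x)
      ((ContinuousLinearEquiv.refl ℝ E : E ≃L[ℝ] E) : E →L[ℝ] E) univ c := by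
    intro x _ y _
    have : x + g x - (y + g y) - (x - y) = g x - g y := by abel
    simpa [this] using hg.norm_sub_le x y
  have hc' : Subsingleton E ∨
      c < ‖((ContinuousLinearEquiv.refl ℝ E).symm : E →L[ℝ] E)‖₊⁻¹ := by
    rcases subsingleton_or_nontrivial E with h | h
    · exact .inl h
    · right
      have : ‖((ContinuousLinearEquiv.refl ℝ E).symm : E →L[ℝ] E)‖₊ = 1 :=
        NNReal.eq ContinuousLinearMap.norm_id
      simpa [this] using hc
  exact ⟨injOn_univ.1 (happ.injOn hc'), happ.surjective hc'⟩

theorem image_eq_of_bijective_of_eqOn_compl {α : Type*} {f : α → α} {s : Set α}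
    (hf : Function.Bijective f) (h : EqOn f id sᶜ) : f '' s = s := by
  rw [← compl_inj_iff, ← image_compl_eq hf, h.image_eq, image_id]

end Lipschitz

section NoRetraction

variable {E : Type*} [NormedAddCommGroup E] [NormedSpace ℝ E] [FiniteDimensional ℝ E]
  [MeasurableSpace E] [BorelSpace E]

/-- A small `C¹` perturbation of the identity vanishing on a sphere preserves the volume of the
ball, computed with the signed Jacobian. -/
theorem exists_setIntegral_det_one_add_smul_fderiv (μ : Measure E) [μ.IsAddHaarMeasure]
    {g : E → E} (hg : ContDiff ℝ 1 g) {R : ℝ} (h0 : ∀ x ∈ sphere (0 : E) R, g x = 0) :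
    ∃ δ : ℝ, 0 < δ ∧ ∀ t : ℝ, 0 < t → t < δ →
      ∫ x in ball (0 : E) R, (1 + t • fderiv ℝ g x).det ∂μ = μ.real (ball (0 : E) R) := by
  have hcd : Continuous (fderiv ℝ g) := hg.continuous_fderiv one_ne_zero
  obtain ⟨B, hB⟩ := (isCompact_closedBall (0 : E) R).exists_bound_of_continuousOn hcd.continuousOn
  set C : ℝ≥0 := B.toNNReal + 1
  have hC : ∀ x ∈ closedBall (0 : E) R, ‖fderiv ℝ g x‖₊ ≤ C := by
    intro x hx
    rw [← NNReal.coe_le_coe, coe_nnnorm]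
    have := B.le_coe_toNNReal
    simp only [C, NNReal.coe_add, NNReal.coe_one]
    linarith [hB x hx]
  have hCpos : (0 : ℝ) < C := by positivity
  have hlip : LipschitzWith C ((closedBall (0 : E) R).indicator g) :=
    ((convex_closedBall 0 R).lipschitzOnWith_of_nnnorm_fderiv_le
      (fun x _ ↦ (hg.differentiable one_ne_zero) x) hC).indicator_closedBall h0
  obtain ⟨ε, hε, hdet⟩ := ContinuousLinearMap.exists_forall_norm_lt_det_one_add_pos (E := E)
  refine ⟨min ε 1 / C, by positivity, fun t ht htδ ↦ ?_⟩
  have htC : t * C < min ε 1 := (lt_div_iff₀ hCpos).1 htδ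
  have hbij : Function.Bijective fun x ↦ x + t • (closedBall (0 : E) R).indicator g x := by
    refine LipschitzWith.bijective_id_add (c := ‖t‖₊ * C) ?_ ?_
    · exact (lipschitzWith_smul t).comp hlip
    · rw [← NNReal.coe_lt_coe]
      simpa [abs_of_pos ht] using htC.trans_le (min_le_right _ _)
  have heq : EqOn (fun x ↦ x + t • (closedBall (0 : E) R).indicator g x)
      (fun x ↦ x + t • g x) (ball 0 R) := fun x hx ↦ by
    simp [indicator_of_mem (ball_subset_closedBall hx)]
  have himg : (fun x ↦ x + t • g x) '' ball 0 R = ball 0 R := by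
    rw [← heq.image_eq]
    refine image_eq_of_bijective_of_eqOn_compl hbij fun x hx ↦ ?_
    by_cases hx' : x ∈ closedBall (0 : E) R
    · have : x ∈ sphere (0 : E) R := by
        rw [← closedBall_sdiff_ball]
        exact ⟨hx', hx⟩
      simp [h0 x this]
    · simp [indicator_of_notMem hx']
  have hinj : InjOn (fun x ↦ x + t • g x) (ball 0 R) := hbij.1.injOn.congr heq
  have hder : ∀ x ∈ ball (0 : E) R, HasFDerivWithinAt (fun x ↦ x + t • g x)
      (1 + t • fderiv ℝ g x) (ball 0 R) x := fun x _ ↦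
    ((hasFDerivAt_id x).add
      (((hg.differentiable one_ne_zero) x).hasFDerivAt.const_smul t)).hasFDerivWithinAt
  have h := integral_image_eq_integral_abs_det_fderiv_smul μ measurableSet_ball hder hinj
    (fun _ ↦ (1 : ℝ))
  rw [himg] at h
  simp only [integral_const, smul_eq_mul, mul_one, measureReal_restrict_apply_univ] at h
  rw [h]
  refine setIntegral_congr_fun measurableSet_ball fun x hx ↦ (abs_of_pos (hdet _ ?_)).symm
  rw [norm_smul, Real.norm_of_nonneg ht.le]
  have hCx : ‖fderiv ℝ g x‖ ≤ C := hC x (ball_subset_closedBall hx)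
  exact ((mul_le_mul_of_nonneg_left hCx ht.le).trans_lt htC).trans_le (min_le_left _ _)

theorem setIntegral_det_one_add_fderiv_eq_measureReal_ball (μ : Measure E) [μ.IsAddHaarMeasure]
    {g : E → E} (hg : ContDiff ℝ 1 g) {R : ℝ} (h0 : ∀ x ∈ sphere (0 : E) R, g x = 0) :
    ∫ x in ball (0 : E) R, (1 + fderiv ℝ g x).det ∂μ = μ.real (ball (0 : E) R) := by
  obtain ⟨δ, hδ, h⟩ := exists_setIntegral_det_one_add_smul_fderiv μ hg h0
  obtain ⟨v, w, hv, hvw⟩ := Polynomial.exists_eval_one_eq_sum (finrank ℝ E) hδ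
  have hw : ∑ i, w i = 1 := by simpa using (hvw 1 (by simp)).symm
  have hpt : ∀ x, (1 + fderiv ℝ g x).det = ∑ i, w i * (1 + v i • fderiv ℝ g x).det := by
    intro x
    obtain ⟨p, hp, hpe⟩ := (fderiv ℝ g x).exists_polynomial_det_one_add_smul
    simpa [hpe] using hvw p hp
  have hint : ∀ t : ℝ, IntegrableOn (fun x ↦ (1 + t • fderiv ℝ g x).det) (ball 0 R) μ := by
    intro t
    have hc : Continuous fun x ↦ (1 + t • fderiv ℝ g x).det :=
      ContinuousLinearMap.continuous_det.comp
        (continuous_const.add ((hg.continuous_fderiv one_ne_zero).const_smul t))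
    exact (hc.continuousOn.integrableOn_compact (isCompact_closedBall 0 R)).mono_set
      ball_subset_closedBall
  simp_rw [hpt]
  rw [integral_finsetSum _ fun i _ ↦ (hint (v i)).const_mul (w i)]
  simp_rw [integral_const_mul, fun i ↦ h (v i) (hv i).1 (hv i).2]
  rw [← Finset.sum_mul, hw, one_mul]

end NoRetraction

section Sphere

variable {E : Type*} [NormedAddCommGroup E] [InnerProductSpace ℝ E] [FiniteDimensional ℝ E]

theorem det_fderiv_eq_zero_of_norm_eq_const {F : E → E} {R : ℝ} (hR : R ≠ 0)
    (hF : Differentiable ℝ F) (h : ∀ x, ‖F x‖ = R) (x : E) : (fderiv ℝ F x).det = 0 := by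
  have horth : ∀ v, inner ℝ (F x) (fderiv ℝ F x v) = 0 := by
    intro v
    have h1 := ((hF x).hasFDerivAt.norm_sq)
    have h2 : (fun y ↦ ‖F y‖ ^ 2) = fun _ ↦ R ^ 2 := by ext y; rw [h]
    rw [h2] at h1
    have h3 := congrArg (fun L ↦ L v) (h1.unique (hasFDerivAt_const (R ^ 2) x))
    simpa using h3
  by_contra hdet
  obtain ⟨v, hv⟩ := ((LinearMap.equivOfDetNeZero _ hdet).surjective (F x))
  have hv' : fderiv ℝ F x v = F x := hv
  have := horth v
  rw [hv', inner_self_eq_zero] at this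
  exact hR (by rw [← h x, this, norm_zero])

/-- There is no `C¹` map from the space to a sphere restricting to the identity on the sphere. -/
theorem not_exists_contDiff_retraction_sphere {R : ℝ} (hR : 0 < R) {F : E → E}
    (hF : ContDiff ℝ 1 F) (hnorm : ∀ x, ‖F x‖ = R) : ∃ x ∈ sphere (0 : E) R, F x ≠ x := by
  by_contra! hfix
  borelize E
  have hmain := setIntegral_det_one_add_fderiv_eq_measureReal_ball (μ := volume)
    (g := fun x ↦ F x - x) (hF.sub contDiff_id) (R := R) fun x hx ↦ by simp [hfix x hx]
  have hzero : ∀ x, (1 + fderiv ℝ (fun x ↦ F x - x) x).det = 0 := by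
    intro x
    rw [fderiv_fun_sub (hF.differentiable one_ne_zero x) differentiableAt_fun_id, fderiv_fun_id]
    rw [← det_fderiv_eq_zero_of_norm_eq_const hR.ne' (hF.differentiable one_ne_zero) hnorm x]
    congr 1
    exact add_sub_cancel _ _
  simp only [hzero, integral_zero] at hmain
  exact (ENNReal.toReal_pos (measure_ball_pos volume (0 : E) hR).ne' measure_ball_lt_top.ne).ne hmain

theorem exists_eq_zero_of_eqOn_compl_compact {f : E → E} (hf : Continuous f) {K : Set E}
    (hK : IsCompact K) (hfix : EqOn f id Kᶜ) : ∃ x, f x = 0 := by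
  by_contra! hne
  obtain ⟨R, hR, hKR⟩ := hK.isBounded.subset_ball_lt 0 0
  let t : E → Set E := fun x ↦ {y | (x ∈ ball (0 : E) R → y ∈ ball (f x) ‖f x‖) ∧
    (x ∉ ball (0 : E) R → y = x)}
  have ht : ∀ x, Convex ℝ (t x) := by
    intro x
    by_cases hx : x ∈ ball (0 : E) R
    · have : t x = ball (f x) ‖f x‖ := by ext y; simp only [t, mem_ofPred_eq, hx]; tauto
      rw [this]
      exact convex_ball _ _
    · have : t x = {x} := by ext y; simp only [t, mem_ofPred_eq, hx, mem_singleton_iff]; tauto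
      rw [this]
      exact convex_singleton _
  obtain ⟨G, hG⟩ := exists_contMDiffMap_forall_mem_convex_of_local (n := 1) 𝓘(ℝ, E) ht (by
    intro x
    by_cases hx : x ∈ K
    · refine ⟨ball 0 R ∩ {y | dist (f x) (f y) < ‖f y‖}, ?_, fun _ ↦ f x, contMDiffOn_const, ?_⟩
      · refine inter_mem (isOpen_ball.mem_nhds (hKR hx)) ?_
        refine (isOpen_lt (continuous_const.dist hf) hf.norm).mem_nhds ?_
        simpa using hne x
      · exact fun y hy ↦ ⟨fun _ ↦ hy.2, fun h ↦ (h hy.1).elim⟩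
    · refine ⟨Kᶜ, hK.isClosed.isOpen_compl.mem_nhds hx, id, contMDiffOn_id, fun y hy ↦ ?_⟩
      refine ⟨fun _ ↦ ?_, fun _ ↦ rfl⟩
      rw [hfix hy]
      have := hne y
      rw [hfix hy] at this
      exact mem_ball_self (norm_pos_iff.2 this))
  have hGsmooth : ContDiff ℝ 1 G := G.contMDiff.contDiff
  have hG0 : ∀ x, G x ≠ 0 := by
    intro x h
    have hx := hG x
    rw [h] at hx
    by_cases hxR : x ∈ ball (0 : E) R
    · simpa using hx.1 hxR
    · rw [← hx.2 hxR] at hxR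
      exact hxR (mem_ball_self hR)
  obtain ⟨x, hx, hxne⟩ := not_exists_contDiff_retraction_sphere hR
    (F := fun x ↦ (R * ‖G x‖⁻¹) • G x)
    ((contDiff_const.mul ((hGsmooth.norm ℝ hG0).inv fun x ↦ norm_ne_zero_iff.2 (hG0 x))).smul
      hGsmooth)
    (fun x ↦ by
      have := norm_ne_zero_iff.2 (hG0 x)
      rw [norm_smul, norm_mul, norm_inv, norm_norm, Real.norm_of_nonneg hR.le]
      field_simp)
  have hxn : ‖x‖ = R := by simpa using hx
  have hGx : G x = x := (hG x).2 (by simp [hxn])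
  exact hxne (by simp [hGx, hxn, hR.ne'])

theorem surjective_of_eqOn_compl_compact {f : E → E} (hf : Continuous f) {K : Set E}
    (hK : IsCompact K) (hfix : EqOn f id Kᶜ) : Function.Surjective f := by
  intro p
  obtain ⟨x, hx⟩ := exists_eq_zero_of_eqOn_compl_compact (f := fun x ↦ f (x + p) - p)
    (by fun_prop) (K := Homeomorph.addRight p ⁻¹' K)
    ((Homeomorph.addRight p).isCompact_preimage.2 hK) fun x hx ↦ by
      have : f (x + p) = x + p := hfix hx
      simp [this]
  exact ⟨x + p, sub_eq_zero.1 hx⟩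

end Sphere

theorem isProperMap_of_eqOn_compl_compact {X : Type*} [TopologicalSpace X] [T2Space X]
    [WeaklyLocallyCompactSpace X] {f : X → X} (hf : Continuous f) {K : Set X}
    (hK : IsCompact K) (hfix : EqOn f id Kᶜ) : IsProperMap f := by
  rw [isProperMap_iff_tendsto_cocompact]
  refine ⟨hf, tendsto_id.congr' ?_⟩
  filter_upwards [hK.compl_mem_cocompact] with x hx using (hfix hx).symm

/-- A continuous injective self-map of ℝⁿ which is the identity outside a compact set
is surjective and is a homeomorphism of ℝⁿ onto itself. -/
theorem compactly_supported_continuous_injective_is_homeomorph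
    (n : ℕ) (hn : 1 ≤ n)
    (K : Set (EuclideanSpace ℝ (Fin n))) (hK : IsCompact K)
    (f : EuclideanSpace ℝ (Fin n) → EuclideanSpace ℝ (Fin n))
    (hcont : Continuous f)
    (hinj : Function.Injective f)
    (hfix : ∀ x ∉ K, f x = x) :
    Function.Surjective f ∧
      ∃ h : EuclideanSpace ℝ (Fin n) ≃ₜ EuclideanSpace ℝ (Fin n), ⇑h = f := by
  have hid : EqOn f id Kᶜ := fun x hx ↦ hfix x hx
  have hsurj : Function.Surjective f := surjective_of_eqOn_compl_compact hcont hK hid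
  exact ⟨hsurj, (Equiv.ofBijective f ⟨hinj, hsurj⟩).toHomeomorphOfContinuousClosed hcont
    (isProperMap_of_eqOn_compl_compact hcont hK hid).isClosedMap, rfl⟩
end

section
/- Let n ≥ 1 and let S : ℝⁿ × ℝⁿ → ℝ be a C¹ function with compact support. Assume that for every η ∈ ℝⁿ the map x ↦ x + ∇_η S(x,η) is injective on ℝⁿ, and for every x ∈ ℝⁿ the map η ↦ η + ∇_x S(x,η) is injective on ℝⁿ. Then each of these maps is a homeomorphism of ℝⁿ onto itself, and there exists a unique bijection φ : ℝⁿ × ℝⁿ → ℝⁿ × ℝⁿ generated by S; moreover this φ is a homeomorphism and equals the identity outside some compact set. -/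
/-- `φ` is generated by `S` (in the explicit Weinstein chart of `ℝ²ⁿ`) if
`φ (x, η + ∇ₓS(x,η)) = (x + ∇_η S(x,η), η)` for all `(x, η)`. -/
def GeneratedBy {n : ℕ}
    (S : EuclideanSpace ℝ (Fin n) × EuclideanSpace ℝ (Fin n) → ℝ)
    (φ : EuclideanSpace ℝ (Fin n) × EuclideanSpace ℝ (Fin n) →
         EuclideanSpace ℝ (Fin n) × EuclideanSpace ℝ (Fin n)) : Prop :=
  ∀ x η : EuclideanSpace ℝ (Fin n),
    φ (x, η + gradient (fun x' => S (x', η)) x) =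
      (x + gradient (fun η' => S (x, η')) η, η)

theorem LinearMap.exists_det_one_add_eq_sum {𝕜 E : Type*} [Field 𝕜] [AddCommGroup E] [Module 𝕜 E]
    [FiniteDimensional 𝕜 E] {s : Finset 𝕜} (hs : Module.finrank 𝕜 E < s.card) :
    ∃ c : 𝕜 → 𝕜, (∑ t ∈ s, c t) = 1 ∧
      ∀ A : E →ₗ[𝕜] E, LinearMap.det (1 + A : E →ₗ[𝕜] E) =
        ∑ t ∈ s, c t * LinearMap.det (1 + t • A : E →ₗ[𝕜] E) := by
  classical
  have hinj : Set.InjOn (_root_.id : 𝕜 → 𝕜) s := fun _ _ _ _ h => h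
  refine ⟨fun t => (Lagrange.basis s _root_.id t).eval 1, ?_, fun A => ?_⟩
  · rw [← Polynomial.eval_finsetSum, Lagrange.sum_basis hinj (Finset.card_pos.1 (by lia)),
      Polynomial.eval_one]
  · let b := Module.finBasis 𝕜 E
    let M := LinearMap.toMatrix b b A
    let p : Polynomial 𝕜 := Matrix.det
      ((Polynomial.X : Polynomial 𝕜) • M.map Polynomial.C +
        (1 : Matrix _ _ 𝕜).map Polynomial.C)
    have hp (t : 𝕜) : p.eval t = LinearMap.det (1 + t • A : E →ₗ[𝕜] E) := by
      rw [← LinearMap.det_toMatrix b]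
      simp only [p, ← Polynomial.coe_evalRingHom, RingHom.map_det]
      congr 1
      ext i j
      simp [M, Matrix.one_apply, LinearMap.toMatrix_one, apply_ite]
      split_ifs <;> ring
    have hdeg : p.degree < s.card := by
      refine lt_of_le_of_lt Polynomial.degree_le_natDegree ?_
      have := Polynomial.natDegree_det_X_add_C_le M 1
      rw [Fintype.card_fin] at this
      exact_mod_cast this.trans_lt hs
    have h1 := congrArg (Polynomial.eval 1) (Lagrange.eq_interpolate hinj hdeg)
    rw [hp, one_smul, Lagrange.interpolate_apply, Polynomial.eval_finsetSum] at h1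
    rw [h1]
    refine Finset.sum_congr rfl fun t _ => ?_
    simp [hp, mul_comm]

theorem ContinuousLinearMap.det_one_add_pos {E : Type*} [NormedAddCommGroup E]
    [NormedSpace ℝ E] [FiniteDimensional ℝ E] {A : E →L[ℝ] E} (hA : ‖A‖ < 1) :
    0 < (1 + A).det := by
  have : CompleteSpace E := FiniteDimensional.complete ℝ E
  have hne (s : ℝ) (hs : s ∈ Set.Icc (0 : ℝ) 1) : (1 + s • A).det ≠ 0 := by
    have h : ‖-(s • A)‖ < 1 := by
      rw [norm_neg, norm_smul, Real.norm_of_nonneg hs.1]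
      nlinarith [hs.2, norm_nonneg A]
    have h2 := isUnit_one_sub_of_norm_lt_one h
    rw [sub_neg_eq_add] at h2
    have h3 : IsUnit ((1 + s • A : E →L[ℝ] E) : E →ₗ[ℝ] E) :=
      h2.map ContinuousLinearMap.toLinearMapRingHom
    exact (h3.map LinearMap.det).ne_zero
  by_contra! hle
  have hc : Continuous fun s : ℝ => (1 + s • A).det :=
    ContinuousLinearMap.continuous_det.comp (by fun_prop)
  have h01 := intermediate_value_Icc' zero_le_one hc.continuousOn
  obtain ⟨s, hs, hs0⟩ := h01 (show (0 : ℝ) ∈ _ by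
    simpa only [one_smul, zero_smul, add_zero, Set.mem_Icc] using
      ⟨hle, zero_le_one.trans_eq (LinearMap.det_id (A := ℝ) (M := E)).symm⟩)
  exact hne s hs hs0

theorem lipschitzWith_indicator_closedBall {E F : Type*} [NormedAddCommGroup E] [NormedSpace ℝ E]
    [NormedAddCommGroup F] {g : E → F} {R : ℝ} {K : NNReal}
    (hg : LipschitzOnWith K g (Metric.closedBall 0 R)) (h0 : ∀ x, ‖x‖ = R → g x = 0) :
    LipschitzWith K ((Metric.closedBall 0 R).indicator g) := by
  have key (x z : E) (hx : x ∈ Metric.closedBall (0 : E) R) (hz : z ∉ Metric.closedBall (0 : E) R) :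
      ‖g x‖ ≤ K * ‖x - z‖ := by
    rw [mem_closedBall_zero_iff] at hx hz
    have hc : Continuous fun s : ℝ => ‖x + s • (z - x)‖ := by fun_prop
    obtain ⟨s, hs, hsR⟩ := intermediate_value_Icc zero_le_one hc.continuousOn
      (show R ∈ _ by simpa using ⟨hx, (not_le.1 hz).le⟩)
    have h1 := hg.norm_sub_le (mem_closedBall_zero_iff.2 hx)
      (mem_closedBall_zero_iff.2 (le_of_eq hsR))
    rw [h0 _ hsR, sub_zero, sub_add_cancel_left, norm_neg, norm_smul, Real.norm_of_nonneg hs.1,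
      norm_sub_rev z x] at h1
    refine h1.trans ?_
    gcongr
    exact mul_le_of_le_one_left (norm_nonneg _) hs.2
  refine LipschitzWith.of_dist_le_mul fun x z => ?_
  rw [dist_eq_norm, dist_eq_norm]
  by_cases hx : x ∈ Metric.closedBall (0 : E) R <;> by_cases hz : z ∈ Metric.closedBall (0 : E) R
  · simpa [hx, hz] using hg.norm_sub_le hx hz
  · simpa only [Set.indicator_of_mem hx, Set.indicator_of_notMem hz, sub_zero] using key x z hx hz
  · simpa only [Set.indicator_of_mem hz, Set.indicator_of_notMem hx, zero_sub, norm_neg,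
      norm_sub_rev x z] using key z x hz hx
  · simp only [Set.indicator_of_notMem hx, Set.indicator_of_notMem hz, sub_zero, norm_zero]
    positivity

theorem LipschitzWith.surjective_id_add {E : Type*} [NormedAddCommGroup E] [CompleteSpace E]
    {K : NNReal} {g : E → E} (hg : LipschitzWith K g) (hK : K < 1) :
    Function.Surjective fun x => x + g x := by
  intro y
  have hc : ContractingWith K fun x => y - g x :=
    ⟨hK, LipschitzWith.of_dist_le_mul fun a b => by
      rw [dist_sub_left]; exact hg.dist_le_mul a b⟩
  have h := hc.fixedPoint_isFixedPt
  exact ⟨_, (eq_sub_iff_add_eq.1 h.symm)⟩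

theorem LipschitzOnWith.injOn_id_add {E : Type*} [NormedAddCommGroup E]
    {K : NNReal} {g : E → E} {s : Set E} (hg : LipschitzOnWith K g s) (hK : K < 1) :
    Set.InjOn (fun x => x + g x) s := by
  intro x hx y hy hxy
  have h1 := hg.norm_sub_le hx hy
  have h2 : x - y = -(g x - g y) := by
    have : x + g x = y + g y := hxy
    rw [neg_sub, sub_eq_sub_iff_add_eq_add, this, add_comm]
  rw [← norm_neg (g x - g y), ← h2] at h1
  have : (K : ℝ) < 1 := hK
  have h3 : ‖x - y‖ = 0 := by nlinarith [norm_nonneg (x - y)]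
  exact sub_eq_zero.1 (norm_eq_zero.1 h3)

open MeasureTheory Metric in
/-- There is no `C¹` retraction of a closed ball onto its boundary sphere: along the segment from the
identity to a retraction, the integral of the Jacobian determinant would be a polynomial in the
parameter, constant near the identity and zero at the retraction. -/
theorem exists_norm_ne_of_eqOn_sphere {E : Type*} [NormedAddCommGroup E] [InnerProductSpace ℝ E]
    [FiniteDimensional ℝ E] {f : E → E} (hf : ContDiff ℝ 1 f) {R : ℝ} (hR : 0 < R)
    (hfs : ∀ x, ‖x‖ = R → f x = x) : ∃ x ∈ closedBall (0 : E) R, ‖f x‖ ≠ R := by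
  by_contra! hcon
  have : CompleteSpace E := FiniteDimensional.complete ℝ E
  borelize E
  let μ : Measure E := Measure.addHaar
  set B : Set E := closedBall 0 R with hB
  have hBc : IsCompact B := isCompact_closedBall _ _
  let g : E → E := fun x => f x - x
  have hg : ContDiff ℝ 1 g := hf.sub contDiff_id
  have hgd (x : E) : HasFDerivAt g (fderiv ℝ g x) x :=
    (hg.differentiable one_ne_zero x).hasFDerivAt
  have hg'c : Continuous (fderiv ℝ g) := hg.continuous_fderiv one_ne_zero
  obtain ⟨C, hC⟩ := hBc.exists_bound_of_continuousOn hg'c.continuousOn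
  let K : NNReal := C.toNNReal + 1
  have hK0 : (0 : ℝ) < K := by positivity
  have hCK (x : E) (hx : x ∈ B) : ‖fderiv ℝ g x‖ ≤ K :=
    (hC x hx).trans (by simp only [K, NNReal.coe_add, NNReal.coe_one]; linarith [C.le_coe_toNNReal])
  have hgL : LipschitzOnWith K g B :=
    (convex_closedBall (0 : E) R).lipschitzOnWith_of_nnnorm_fderiv_le
      (fun x _ => (hgd x).differentiableAt) (fun x hx => hCK x hx)
  have hgs (x : E) (hx : ‖x‖ = R) : g x = 0 := sub_eq_zero.2 (hfs x hx)
  have hvol (t : ℝ) (ht0 : 0 < t) (ht1 : t < 1) (htK : t * K < 1) :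
      ∫ x in B, (1 + t • fderiv ℝ g x).det ∂μ = μ.real B := by
    let T : NNReal := ⟨t, ht0.le⟩
    have hTK : T * K < 1 := htK
    have hL : LipschitzOnWith (T * K) (fun x => t • g x) B :=
      LipschitzOnWith.of_dist_le_mul fun x hx y hy => by
        rw [dist_smul₀, Real.norm_of_nonneg ht0.le, NNReal.coe_mul, mul_assoc]
        exact mul_le_mul_of_nonneg_left (hgL.dist_le_mul x hx y hy) ht0.le
    have himg : (fun x => x + t • g x) '' B = B := by
      apply Set.Subset.antisymm
      · rintro _ ⟨x, hx, rfl⟩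
        have hfx : f x ∈ B := mem_closedBall_zero_iff.2 (hcon x hx).le
        have := (convex_closedBall (0 : E) R) hx hfx (sub_nonneg.2 ht1.le) ht0.le
          (sub_add_cancel 1 t)
        convert this using 1
        simp only [g]
        module
      · intro y hy
        obtain ⟨x, hx⟩ := (lipschitzWith_indicator_closedBall hL
          fun x hx => by simp [hgs x hx]).surjective_id_add hTK y
        by_cases hxB : x ∈ B
        · exact ⟨x, hxB, by
            rw [← hx]
            simp only [Set.indicator_of_mem (show x ∈ closedBall (0 : E) R from hxB)]⟩
        · simp only [Set.indicator_of_notMem (show x ∉ closedBall (0 : E) R from hxB),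
            add_zero] at hx
          exact absurd (hx ▸ hy) hxB
    have h := integral_image_eq_integral_abs_det_fderiv_smul μ hBc.measurableSet
      (f := fun x => x + t • g x) (f' := fun x => 1 + t • fderiv ℝ g x)
      (fun x _ => ((hasFDerivAt_id x).add ((hgd x).const_smul t)).hasFDerivWithinAt)
      (hL.injOn_id_add hTK) (fun _ => (1 : ℝ))
    rw [himg] at h
    simp only [integral_const, smul_eq_mul, mul_one, measureReal_restrict_apply_univ] at h
    rw [h]
    refine setIntegral_congr_fun hBc.measurableSet fun x hx => ?_
    refine (abs_of_pos (ContinuousLinearMap.det_one_add_pos ?_)).symm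
    rw [norm_smul, Real.norm_of_nonneg ht0.le]
    exact (mul_le_mul_of_nonneg_left (hCK x hx) ht0.le).trans_lt htK
  obtain ⟨s, hs, hcard⟩ := (Set.Ioo_infinite (lt_min one_pos (inv_pos.2 hK0))
    : (Set.Ioo 0 (min 1 (K : ℝ)⁻¹)).Infinite).exists_subset_card_eq (Module.finrank ℝ E + 1)
  obtain ⟨c, hc1, hc⟩ := LinearMap.exists_det_one_add_eq_sum (𝕜 := ℝ) (E := E) (s := s) (by lia)
  have hdet0 (x : E) (hx : x ∈ B) (hx' : x ∈ ball (0 : E) R) : (1 + fderiv ℝ g x).det = 0 := by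
    have hfd : HasFDerivAt f (1 + fderiv ℝ g x) x := by
      have := (hasFDerivAt_id x).add (hgd x)
      convert! this using 1
      ext y
      simp [g]
    have hsq : HasFDerivAt (fun y => ‖f y‖ ^ 2) (0 : E →L[ℝ] ℝ) x := by
      refine (hasFDerivAt_const (R ^ 2) x).congr_of_eventuallyEq ?_
      filter_upwards [isOpen_ball.mem_nhds hx'] with y hy
      rw [hcon y (ball_subset_closedBall hy)]
    have horth := hfd.norm_sq.unique hsq
    by_contra hne
    have hsurj := (LinearMap.equivOfDetNeZero _ hne).surjective (f x)
    obtain ⟨v, hv⟩ := hsurj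
    have h1 := congrArg (fun L : E →L[ℝ] ℝ => L v) horth
    have hv' : (1 + fderiv ℝ g x) v = f x := hv
    have h2 : (2 : ℕ) • inner ℝ (f x) ((1 + fderiv ℝ g x) v) = (0 : ℝ) := h1
    rw [hv', real_inner_self_eq_norm_sq, hcon x hx] at h2
    exact (by positivity : (2 : ℕ) • R ^ 2 ≠ 0) h2
  have hint (t : ℝ) : IntegrableOn (fun x => c t * (1 + t • fderiv ℝ g x).det) B μ := by
    refine ContinuousOn.integrableOn_compact hBc (Continuous.continuousOn ?_)
    exact continuous_const.mul (ContinuousLinearMap.continuous_det.comp (by fun_prop))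
  have hsum : ∫ x in B, (1 + fderiv ℝ g x).det ∂μ = μ.real B := by
    calc ∫ x in B, (1 + fderiv ℝ g x).det ∂μ
        = ∫ x in B, ∑ t ∈ s, c t * (1 + t • fderiv ℝ g x).det ∂μ :=
          integral_congr_ae (.of_forall fun x => hc (fderiv ℝ g x))
      _ = ∑ t ∈ s, c t * μ.real B := by
          rw [integral_finsetSum _ fun t _ => hint t]
          refine Finset.sum_congr rfl fun t ht => ?_
          obtain ⟨ht0, ht1⟩ := hs ht
          rw [integral_const_mul, hvol t ht0 (ht1.trans_le (min_le_left _ _))]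
          have := ht1.trans_le (min_le_right _ _)
          rwa [lt_inv_comm₀ ht0 hK0, ← one_div, lt_div_iff₀ ht0, mul_comm] at this
      _ = μ.real B := by rw [← Finset.sum_mul, hc1, one_mul]
  have hzero : ∫ x in B, (1 + fderiv ℝ g x).det ∂μ = 0 := by
    refine setIntegral_eq_zero_of_ae_eq_zero ?_
    filter_upwards [measure_eq_zero_iff_ae_notMem.1
      (Measure.addHaar_sphere_of_ne_zero μ (0 : E) hR.ne')] with x hx hxB
    refine hdet0 x hxB (mem_ball.2 (lt_of_le_of_ne (mem_closedBall.1 hxB) hx))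
  have hpos : 0 < μ.real B :=
    ENNReal.toReal_pos (measure_closedBall_pos μ _ hR).ne' hBc.measure_lt_top.ne
  exact hpos.ne' (hsum.symm.trans hzero)

theorem tendsto_cocompact_of_hasCompactSupport_sub {E : Type*} [TopologicalSpace E] [AddGroup E]
    {F : E → E} (hc : HasCompactSupport fun x => F x - x) :
    Filter.Tendsto F (Filter.cocompact E) (Filter.cocompact E) := by
  refine Filter.tendsto_id.congr' ?_
  filter_upwards [hc.isCompact.compl_mem_cocompact] with x hx
  exact (sub_eq_zero.1 (image_eq_zero_of_notMem_tsupport (f := fun x => F x - x) hx)).symm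

theorem isClosedMap_of_hasCompactSupport_sub {E : Type*} [TopologicalSpace E] [AddGroup E]
    [T2Space E] [LocallyCompactSpace E] {F : E → E} (hF : Continuous F)
    (hc : HasCompactSupport fun x => F x - x) : IsClosedMap F :=
  (isProperMap_iff_tendsto_cocompact.2
    ⟨hF, tendsto_cocompact_of_hasCompactSupport_sub hc⟩).isClosedMap

open Metric in
theorem surjective_of_contDiff_of_hasCompactSupport_sub {E : Type*} [NormedAddCommGroup E]
    [InnerProductSpace ℝ E] [FiniteDimensional ℝ E] {F : E → E} (hF : ContDiff ℝ 1 F)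
    (hc : HasCompactSupport fun x => F x - x) : Function.Surjective F := by
  intro y
  by_contra! hy
  obtain ⟨r, hr⟩ := hc.isCompact.isBounded.subset_ball y
  have hR : 0 < max r 1 := lt_max_of_lt_right one_pos
  let G : E → E := fun x => F (x + y) - y
  have hG : ContDiff ℝ 1 G := (hF.comp (contDiff_id.add contDiff_const)).sub contDiff_const
  have hG0 (x : E) : G x ≠ 0 := sub_ne_zero.2 (hy _)
  have hGR (x : E) (hx : ‖x‖ = max r 1) : G x = x := by
    have : x + y ∉ tsupport fun x => F x - x := fun h => by
      have := hr h
      rw [mem_ball, dist_add_self_left, hx] at this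
      exact (le_max_left r 1).not_gt this
    have h : F (x + y) - (x + y) = 0 :=
      image_eq_zero_of_notMem_tsupport (f := fun x => F x - x) this
    rw [show G x = F (x + y) - (x + y) + x by simp only [G]; abel, h, zero_add]
  obtain ⟨x, -, hx⟩ := exists_norm_ne_of_eqOn_sphere (f := fun x => (max r 1 * ‖G x‖⁻¹) • G x)
    ((contDiff_const.mul ((hG.norm ℝ hG0).inv fun x => norm_ne_zero_iff.2 (hG0 x))).smul hG) hR
    fun x hx => by rw [hGR x hx, hx, mul_inv_cancel₀ hR.ne', one_smul]
  refine hx ?_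
  rw [norm_smul, norm_mul, norm_inv, norm_norm, Real.norm_of_nonneg hR.le, mul_assoc,
    inv_mul_cancel₀ (norm_ne_zero_iff.2 (hG0 x)), mul_one]

/-- A continuous self-map of a finite-dimensional Euclidean space that is the identity outside a
compact set is surjective. -/
theorem surjective_of_continuous_of_hasCompactSupport_sub {E : Type*} [NormedAddCommGroup E]
    [InnerProductSpace ℝ E] [FiniteDimensional ℝ E] {F : E → E} (hF : Continuous F)
    (hc : HasCompactSupport fun x => F x - x) : Function.Surjective F := by
  have : ProperSpace E := FiniteDimensional.proper ℝ E
  intro y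
  by_contra hy
  obtain ⟨δ, hδ, hball⟩ := Metric.isOpen_iff.1
    (isClosedMap_of_hasCompactSupport_sub hF hc).isClosed_range.isOpen_compl y hy
  have hg : Continuous fun x => F x - x := hF.sub continuous_id
  obtain ⟨ε, hε, hu⟩ := Metric.uniformContinuous_iff.1
    (hc.uniformContinuous_of_continuous hg) (δ / 2) (half_pos hδ)
  obtain ⟨g, hgs, hgd⟩ := hg.exists_contDiff_dist_le_of_forall_mem_ball_dist_le
    (half_pos hε)
  have hgc : HasCompactSupport g := by
    refine HasCompactSupport.intro (hc.isCompact.cthickening (r := ε)) fun x hx => ?_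
    have hzero (z : E) (hz : dist z x < ε) : F z - z = 0 := by
      refine image_eq_zero_of_notMem_tsupport (f := fun x => F x - x) fun hz' => hx ?_
      exact Metric.mem_cthickening_of_dist_le x z ε _ hz' (by rw [dist_comm]; exact hz.le)
    have := hgd x 0 fun z hz => by
      simp only [hzero z ((Metric.mem_ball.1 hz).trans (half_lt_self hε)),
        hzero x (by simpa using hε), dist_self, le_refl]
    simpa only [hzero x (by simpa using hε), dist_le_zero] using this
  obtain ⟨x, hx⟩ := surjective_of_contDiff_of_hasCompactSupport_sub
    (F := fun x => x + g x) (contDiff_id.add (hgs.of_le (by simp)))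
    (by simpa only [add_sub_cancel_left] using hgc) y
  have hgF : dist (g x) (F x - x) ≤ δ / 2 :=
    hgd x _ fun z hz => (hu ((Metric.mem_ball.1 hz).trans (half_lt_self hε))).le
  refine hball (a := F x) ?_ ⟨x, rfl⟩
  rw [Metric.mem_ball, ← hx, dist_comm, ← dist_sub_right _ _ x, add_sub_cancel_left]
  exact hgF.trans_lt (half_lt_self hδ)

theorem isHomeomorph_of_injective_of_hasCompactSupport_sub {E : Type*} [NormedAddCommGroup E]
    [InnerProductSpace ℝ E] [FiniteDimensional ℝ E] {F : E → E} (hF : Continuous F)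
    (hinj : Function.Injective F) (hc : HasCompactSupport fun x => F x - x) : IsHomeomorph F :=
  have : ProperSpace E := FiniteDimensional.proper ℝ E
  isHomeomorph_iff_continuous_isClosedMap_bijective.2
    ⟨hF, isClosedMap_of_hasCompactSupport_sub hF hc, hinj,
      surjective_of_continuous_of_hasCompactSupport_sub hF hc⟩

section PartialGradient

variable {E F : Type*} [NormedAddCommGroup E] [InnerProductSpace ℝ E]
  [NormedAddCommGroup F] [InnerProductSpace ℝ F] {S : E × F → ℝ}

theorem gradient_partial_fst [CompleteSpace E] (hS : Differentiable ℝ S) (z : E × F) :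
    gradient (fun x => S (x, z.2)) z.1 =
      (InnerProductSpace.toDual ℝ E).symm ((fderiv ℝ S z).comp (.inl ℝ E F)) := by
  have h : HasFDerivAt (fun x => S (x, z.2)) ((fderiv ℝ S z).comp (.inl ℝ E F)) z.1 :=
    (hS z).hasFDerivAt.comp z.1 (hasFDerivAt_prodMk_left z.1 z.2)
  rw [gradient, h.fderiv]

theorem gradient_partial_snd [CompleteSpace F] (hS : Differentiable ℝ S) (z : E × F) :
    gradient (fun y => S (z.1, y)) z.2 =
      (InnerProductSpace.toDual ℝ F).symm ((fderiv ℝ S z).comp (.inr ℝ E F)) := by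
  have h : HasFDerivAt (fun y => S (z.1, y)) ((fderiv ℝ S z).comp (.inr ℝ E F)) z.2 :=
    (hS z).hasFDerivAt.comp z.2 (hasFDerivAt_prodMk_right z.1 z.2)
  rw [gradient, h.fderiv]

theorem ContDiff.continuous_gradient_partial_fst [CompleteSpace E] (hS : ContDiff ℝ 1 S) :
    Continuous fun z : E × F => gradient (fun x => S (x, z.2)) z.1 := by
  simp only [gradient_partial_fst (hS.differentiable one_ne_zero)]
  exact (LinearIsometryEquiv.continuous _).comp
    ((hS.continuous_fderiv one_ne_zero).clm_comp continuous_const)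

theorem ContDiff.continuous_gradient_partial_snd [CompleteSpace F] (hS : ContDiff ℝ 1 S) :
    Continuous fun z : E × F => gradient (fun y => S (z.1, y)) z.2 := by
  simp only [gradient_partial_snd (hS.differentiable one_ne_zero)]
  exact (LinearIsometryEquiv.continuous _).comp
    ((hS.continuous_fderiv one_ne_zero).clm_comp continuous_const)

theorem gradient_partial_fst_eq_zero [CompleteSpace E] (hS : Differentiable ℝ S) {z : E × F}
    (hz : z ∉ tsupport S) :
    gradient (fun x => S (x, z.2)) z.1 = 0 := by
  rw [gradient_partial_fst hS, fderiv_of_notMem_tsupport ℝ hz, ContinuousLinearMap.zero_comp,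
    map_zero]

theorem gradient_partial_snd_eq_zero [CompleteSpace F] (hS : Differentiable ℝ S) {z : E × F}
    (hz : z ∉ tsupport S) :
    gradient (fun y => S (z.1, y)) z.2 = 0 := by
  rw [gradient_partial_snd hS, fderiv_of_notMem_tsupport ℝ hz, ContinuousLinearMap.zero_comp,
    map_zero]

end PartialGradient

/-- Admissibility: if the maps `x ↦ x + ∇_η S(x,η)` and `η ↦ η + ∇ₓ S(x,η)` are
injective, they are homeomorphisms of `ℝⁿ`, and `S` generates a unique bijection of
`ℝⁿ × ℝⁿ`, which is a compactly supported homeomorphism. -/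
theorem admissible_generating_function_homeomorph
    (n : ℕ) (hn : 1 ≤ n)
    (S : EuclideanSpace ℝ (Fin n) × EuclideanSpace ℝ (Fin n) → ℝ)
    (hS : ContDiff ℝ 1 S) (hsupp : HasCompactSupport S)
    (hinj₁ : ∀ η : EuclideanSpace ℝ (Fin n),
      Function.Injective fun x => x + gradient (fun η' => S (x, η')) η)
    (hinj₂ : ∀ x : EuclideanSpace ℝ (Fin n),
      Function.Injective fun η => η + gradient (fun x' => S (x', η)) x) :
    (∀ η : EuclideanSpace ℝ (Fin n),
      ∃ h : EuclideanSpace ℝ (Fin n) ≃ₜ EuclideanSpace ℝ (Fin n),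
        ⇑h = fun x => x + gradient (fun η' => S (x, η')) η) ∧
    (∀ x : EuclideanSpace ℝ (Fin n),
      ∃ h : EuclideanSpace ℝ (Fin n) ≃ₜ EuclideanSpace ℝ (Fin n),
        ⇑h = fun η => η + gradient (fun x' => S (x', η)) x) ∧
    (∃ φ : EuclideanSpace ℝ (Fin n) × EuclideanSpace ℝ (Fin n) →
           EuclideanSpace ℝ (Fin n) × EuclideanSpace ℝ (Fin n),
      (Function.Bijective φ ∧ GeneratedBy S φ) ∧
      (∀ ψ, Function.Bijective ψ ∧ GeneratedBy S ψ → ψ = φ) ∧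
      (∃ h : (EuclideanSpace ℝ (Fin n) × EuclideanSpace ℝ (Fin n)) ≃ₜ
             (EuclideanSpace ℝ (Fin n) × EuclideanSpace ℝ (Fin n)), ⇑h = φ) ∧
      (∃ L : Set (EuclideanSpace ℝ (Fin n) × EuclideanSpace ℝ (Fin n)),
        IsCompact L ∧ ∀ z ∉ L, φ z = z)) := by
  have hSd : Differentiable ℝ S := hS.differentiable one_ne_zero
  let A : EuclideanSpace ℝ (Fin n) × EuclideanSpace ℝ (Fin n) →
      EuclideanSpace ℝ (Fin n) × EuclideanSpace ℝ (Fin n) :=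
    fun z => (z.1, z.2 + gradient (fun x => S (x, z.2)) z.1)
  let B : EuclideanSpace ℝ (Fin n) × EuclideanSpace ℝ (Fin n) →
      EuclideanSpace ℝ (Fin n) × EuclideanSpace ℝ (Fin n) :=
    fun z => (z.1 + gradient (fun η => S (z.1, η)) z.2, z.2)
  have hAc : Continuous A :=
    continuous_fst.prodMk (continuous_snd.add hS.continuous_gradient_partial_fst)
  have hBc : Continuous B :=
    (continuous_fst.add hS.continuous_gradient_partial_snd).prodMk continuous_snd
  have hA_id (z) (hz : z ∉ tsupport S) : A z = z :=
    Prod.ext rfl (by simp only [A, gradient_partial_fst_eq_zero hSd hz, add_zero])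
  have hB_id (z) (hz : z ∉ tsupport S) : B z = z :=
    Prod.ext (by simp only [B, gradient_partial_snd_eq_zero hSd hz, add_zero]) rfl
  have h₁ (η : EuclideanSpace ℝ (Fin n)) :
      IsHomeomorph fun x => x + gradient (fun η' => S (x, η')) η := by
    refine isHomeomorph_of_injective_of_hasCompactSupport_sub
      (continuous_fst.comp (hBc.comp (Continuous.prodMk_left η))) (hinj₁ η)
      (HasCompactSupport.intro (hsupp.isCompact.image continuous_fst) fun x hx => ?_)
    rw [add_sub_cancel_left]
    exact gradient_partial_snd_eq_zero hSd (z := (x, η)) fun h => hx ⟨_, h, rfl⟩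
  have h₂ (x : EuclideanSpace ℝ (Fin n)) :
      IsHomeomorph fun η => η + gradient (fun x' => S (x', η)) x := by
    refine isHomeomorph_of_injective_of_hasCompactSupport_sub
      (continuous_snd.comp (hAc.comp (Continuous.prodMk_right x))) (hinj₂ x)
      (HasCompactSupport.intro (hsupp.isCompact.image continuous_snd) fun η hη => ?_)
    rw [add_sub_cancel_left]
    exact gradient_partial_fst_eq_zero hSd (z := (x, η)) fun h => hη ⟨_, h, rfl⟩
  have hA : IsHomeomorph A := by
    refine isHomeomorph_iff_continuous_isClosedMap_bijective.2
      ⟨hAc, isClosedMap_of_hasCompactSupport_sub hAc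
        (.intro hsupp.isCompact fun z hz => sub_eq_zero.2 (hA_id z hz)), ?_, ?_⟩
    · rintro ⟨x, η⟩ ⟨x', η'⟩ h
      obtain rfl : x = x' := congrArg Prod.fst h
      exact Prod.ext rfl (hinj₂ x (congrArg Prod.snd h))
    · rintro ⟨x, ξ⟩
      obtain ⟨η, hη⟩ := (h₂ x).surjective ξ
      exact ⟨(x, η), Prod.ext rfl hη⟩
  have hB : IsHomeomorph B := by
    refine isHomeomorph_iff_continuous_isClosedMap_bijective.2
      ⟨hBc, isClosedMap_of_hasCompactSupport_sub hBc
        (.intro hsupp.isCompact fun z hz => sub_eq_zero.2 (hB_id z hz)), ?_, ?_⟩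
    · rintro ⟨x, η⟩ ⟨x', η'⟩ h
      obtain rfl : η = η' := congrArg Prod.snd h
      exact Prod.ext (hinj₁ η (congrArg Prod.fst h)) rfl
    · rintro ⟨y, η⟩
      obtain ⟨x, hx⟩ := (h₁ η).surjective y
      exact ⟨(x, η), Prod.ext hx rfl⟩
  let Φ := (hA.homeomorph A).symm.trans (hB.homeomorph B)
  have hΦ (z) : Φ (A z) = B z :=
    congrArg B ((hA.homeomorph A).symm_apply_apply z)
  refine ⟨fun η => ⟨(h₁ η).homeomorph _, rfl⟩, fun x => ⟨(h₂ x).homeomorph _, rfl⟩,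
    Φ, ⟨Φ.bijective, fun x η => hΦ (x, η)⟩, ?_, ⟨Φ, rfl⟩, tsupport S, hsupp.isCompact, ?_⟩
  · rintro ψ ⟨-, hψ⟩
    funext w
    obtain ⟨z, rfl⟩ := hA.surjective w
    exact (hψ z.1 z.2).trans (hΦ z).symm
  · intro z hz
    have := hΦ z
    rwa [hA_id z hz, hB_id z hz] at this
end

section
/- Let S : ℝ × ℝ → ℝ be a C¹ function with compact support such that for every (x,η) ∈ ℝ² the function x ↦ x + ∂S/∂η(x,η) (as a function of x, with η fixed) is strictly increasing, and the function η ↦ η + ∂S/∂x(x,η) (as a function of η, with x fixed) is strictly increasing. Then there exists a unique bijection φ : ℝ² → ℝ² generated by S, and this φ is a homeomorphism of ℝ² equal to the identity outside some compact set. -/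
/-- `φ : ℝ² → ℝ²` is generated by `S : ℝ × ℝ → ℝ` if
`φ (x, η + ∂S/∂x (x,η)) = (x + ∂S/∂η (x,η), η)` for all `(x, η)`. -/
def GeneratedBy₁ (S : ℝ × ℝ → ℝ) (φ : ℝ × ℝ → ℝ × ℝ) : Prop :=
  ∀ x η : ℝ,
    φ (x, η + deriv (fun x' => S (x', η)) x) =
      (x + deriv (fun η' => S (x, η')) η, η)

open Filter Topology

/-- A continuous family of increasing bijections of the line is a fibrewise homeomorphism. -/
theorem exists_homeomorph_prod_of_strictMono {X : Type*} [TopologicalSpace X] {F : X → ℝ → ℝ}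
    (hcont : Continuous fun p : X × ℝ => F p.1 p.2) (hmono : ∀ x, StrictMono (F x))
    (hsurj : ∀ x, Function.Surjective (F x)) :
    ∃ h : (X × ℝ) ≃ₜ (X × ℝ), ∀ x t, h (x, t) = (x, F x t) := by
  choose g hg using hsurj
  have hg' : ∀ x t, g x (F x t) = t := fun x t => (hmono x).injective (hg x _)
  have hgcont : Continuous fun p : X × ℝ => g p.1 p.2 := by
    rw [continuous_iff_continuousAt]
    rintro ⟨x, y⟩
    have hF : ∀ a : ℝ, Continuous fun p : X × ℝ => F p.1 a := fun a =>
      hcont.comp (continuous_fst.prodMk continuous_const)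
    refine tendsto_order.2 ⟨fun a ha => ?_, fun a ha => ?_⟩
    · have hlt : F x a < y := by simpa only [hg] using hmono x ha
      filter_upwards [(isOpen_lt (hF a) continuous_snd).mem_nhds hlt] with p hp
      exact (hmono p.1).lt_iff_lt.1 (by simpa only [hg] using hp)
    · have hlt : y < F x a := by simpa only [hg] using hmono x ha
      filter_upwards [(isOpen_lt continuous_snd (hF a)).mem_nhds hlt] with p hp
      exact (hmono p.1).lt_iff_lt.1 (by simpa only [hg] using hp)
  exact ⟨{  toFun := fun p => (p.1, F p.1 p.2)
            invFun := fun p => (p.1, g p.1 p.2)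
            left_inv := fun p => by simp [hg']
            right_inv := fun p => by simp [hg]
            continuous_toFun := continuous_fst.prodMk hcont
            continuous_invFun := continuous_fst.prodMk hgcont }, fun _ _ => rfl⟩

theorem surjective_add_of_bounded {f : ℝ → ℝ} (hf : Continuous f) {C : ℝ}
    (hC : ∀ t, ‖f t‖ ≤ C) : Function.Surjective fun t => t + f t := by
  refine (continuous_id.add hf).surjective ?_ ?_
  · exact tendsto_atTop_add_right_of_le _ (-C) tendsto_id fun t => (abs_le.1 (hC t)).1
  · exact tendsto_atBot_add_right_of_ge _ C tendsto_id fun t => (abs_le.1 (hC t)).2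

/-- Case `n = 1` of Proposition 4.1.1: a compactly supported `C¹` function
`S : ℝ × ℝ → ℝ` whose associated maps `x ↦ x + ∂S/∂η(x,η)` and
`η ↦ η + ∂S/∂x(x,η)` are strictly increasing generates a unique bijection of `ℝ²`,
which is a homeomorphism equal to the identity outside a compact set. -/
theorem admissible_generating_function_one_dim
    (S : ℝ × ℝ → ℝ)
    (hS : ContDiff ℝ 1 S) (hsupp : HasCompactSupport S)
    (hmono₁ : ∀ η : ℝ, StrictMono fun x : ℝ => x + deriv (fun η' => S (x, η')) η)
    (hmono₂ : ∀ x : ℝ, StrictMono fun η : ℝ => η + deriv (fun x' => S (x', η)) x) :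
    ∃ φ : ℝ × ℝ → ℝ × ℝ,
      (Function.Bijective φ ∧ GeneratedBy₁ S φ) ∧
      (∀ ψ, Function.Bijective ψ ∧ GeneratedBy₁ S ψ → ψ = φ) ∧
      (∃ h : (ℝ × ℝ) ≃ₜ (ℝ × ℝ), ⇑h = φ) ∧
      (∃ L : Set (ℝ × ℝ), IsCompact L ∧ ∀ z ∉ L, φ z = z) := by
  have hd : Differentiable ℝ S := hS.differentiable one_ne_zero
  have hx : ∀ x η, deriv (fun x' => S (x', η)) x = fderiv ℝ S (x, η) (1, 0) := fun x η =>
    ((hd (x, η)).hasFDerivAt.comp_hasDerivAt x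
      ((hasDerivAt_id x).prodMk (hasDerivAt_const x η))).deriv
  have hη : ∀ x η, deriv (fun η' => S (x, η')) η = fderiv ℝ S (x, η) (0, 1) := fun x η =>
    ((hd (x, η)).hasFDerivAt.comp_hasDerivAt η
      ((hasDerivAt_const η x).prodMk (hasDerivAt_id η))).deriv
  have hfd : Continuous (fderiv ℝ S) := hS.continuous_fderiv one_ne_zero
  have hc : ∀ v, Continuous fun p => fderiv ℝ S p v := fun v => hfd.clm_apply continuous_const
  have hb : ∀ v, ∃ C, ∀ p, ‖fderiv ℝ S p v‖ ≤ C := fun v =>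
    (hc v).bounded_above_of_compact_support (hsupp.fderiv_apply (𝕜 := ℝ) v)
  have hz : ∀ p ∉ tsupport S, fderiv ℝ S p = 0 := fun p hp =>
    image_eq_zero_of_notMem_tsupport fun h => hp (tsupport_fderiv_subset ℝ h)
  unfold GeneratedBy₁
  simp only [hx, hη] at hmono₁ hmono₂ ⊢
  obtain ⟨C₁, hC₁⟩ := hb (1, 0)
  obtain ⟨C₂, hC₂⟩ := hb (0, 1)
  obtain ⟨A, hA⟩ := exists_homeomorph_prod_of_strictMono
    (F := fun x η : ℝ => η + fderiv ℝ S (x, η) (1, 0)) (continuous_snd.add (hc (1, 0))) hmono₂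
    fun x => surjective_add_of_bounded ((hc (1, 0)).comp (Continuous.prodMk_right x))
      fun η => hC₁ (x, η)
  obtain ⟨B, hB⟩ := exists_homeomorph_prod_of_strictMono
    (F := fun η x : ℝ => x + fderiv ℝ S (x, η) (0, 1))
    (continuous_snd.add ((hc (0, 1)).comp continuous_swap)) hmono₁
    fun η => surjective_add_of_bounded ((hc (0, 1)).comp (Continuous.prodMk_left η))
      fun x => hC₂ (x, η)
  let h := A.symm.trans ((Homeomorph.prodComm ℝ ℝ).trans (B.trans (Homeomorph.prodComm ℝ ℝ)))
  have hh : ∀ x η, h (x, η + fderiv ℝ S (x, η) (1, 0)) =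
      (x + fderiv ℝ S (x, η) (0, 1), η) := fun x η => by
    simp [h, ← hA, hB]
  refine ⟨h, ⟨h.bijective, hh⟩, ?_, ⟨h, rfl⟩, tsupport S, hsupp, ?_⟩
  · rintro ψ ⟨-, hψ⟩
    funext p
    obtain ⟨⟨x, η⟩, rfl⟩ := A.surjective p
    rw [hA, hψ, hh]
  · rintro ⟨x, η⟩ hp
    simpa [hz _ hp] using hh x η
end

section
/- Let n ≥ 1, let S : ℝ × ℝⁿ × ℝⁿ → ℝ be of class C², and let X : ℝ × ℝⁿ × ℝⁿ → ℝⁿ be differentiable and satisfy ξ = X(t,ξ,η) + ∇_η S(t, X(t,ξ,η), η) for all (t,ξ,η). Define H : ℝ × ℝⁿ × ℝⁿ → ℝ by H(t,ξ,η) = (∂S/∂t)(t, X(t,ξ,η), η). Fix x₀, y₀ ∈ ℝⁿ, let η : ℝ → ℝⁿ be differentiable with y₀ = η(t) + ∇_x S(t, x₀, η(t)) for all t, set ξ(t) = x₀ + ∇_η S(t, x₀, η(t)), and assume X(t, ξ(t), η(t)) = x₀ for all t. Then the curve t ↦ (ξ(t), η(t)) satisfies Hamilton's equations for H: for all t, ξ'(t)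 = ∇_η H(t, ξ(t), η(t)) and η'(t) = −∇_ξ H(t, ξ(t), η(t)). -/
open scoped InnerProductSpace

section PartialGradient

variable {E : Type*} [NormedAddCommGroup E] [InnerProductSpace ℝ E] {S : ℝ × (E × E) → ℝ}

theorem deriv_time_eq (hS : Differentiable ℝ S) (t : ℝ) (x y : E) :
    deriv (fun s => S (s, x, y)) t = fderiv ℝ S (t, x, y) (1, 0, 0) := by
  have h : HasDerivAt (fun s : ℝ => (s, x, y)) (1, 0, 0) t :=
    (hasDerivAt_id t).prodMk ((hasDerivAt_const t x).prodMk (hasDerivAt_const t y))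
  exact ((hS (t, x, y)).hasFDerivAt.comp_hasDerivAt t h).deriv

variable [CompleteSpace E]

theorem gradient_eq_of_hasFDerivAt {f : E → ℝ} {f' : E →L[ℝ] ℝ} {x g : E}
    (hf : HasFDerivAt f f' x) (hg : ∀ v, f' v = ⟪g, v⟫_ℝ) : gradient f x = g := by
  refine ext_inner_right ℝ fun v => ?_
  rw [inner_gradient_left, hf.fderiv, hg]

theorem inner_gradient_fst (hS : Differentiable ℝ S) (t : ℝ) (x y v : E) :
    ⟪gradient (fun x' => S (t, x', y)) x, v⟫_ℝ = fderiv ℝ S (t, x, y) (0, v, 0) := by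
  have h := HasFDerivAt.comp x (f := fun x' : E => (t, x', y)) (hS (t, x, y)).hasFDerivAt
    ((hasFDerivAt_const t x).prodMk ((hasFDerivAt_id x).prodMk (hasFDerivAt_const y x)))
  rw [inner_gradient_left]
  exact (DFunLike.congr_fun h.fderiv v).trans (by simp)

theorem inner_gradient_snd (hS : Differentiable ℝ S) (t : ℝ) (x y w : E) :
    ⟪gradient (fun y' => S (t, x, y')) y, w⟫_ℝ = fderiv ℝ S (t, x, y) (0, 0, w) := by
  have h := HasFDerivAt.comp y (f := fun y' : E => (t, x, y')) (hS (t, x, y)).hasFDerivAt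
    ((hasFDerivAt_const t y).prodMk ((hasFDerivAt_const x y).prodMk (hasFDerivAt_id y)))
  rw [inner_gradient_left]
  exact (DFunLike.congr_fun h.fderiv w).trans (by simp)

theorem gradient_snd_eq (hS : Differentiable ℝ S) (t : ℝ) (x y : E) :
    gradient (fun y' => S (t, x, y')) y = (InnerProductSpace.toDual ℝ E).symm
      ((fderiv ℝ S (t, x, y)).comp
        ((ContinuousLinearMap.inr ℝ ℝ (E × E)).comp (ContinuousLinearMap.inr ℝ E E))) := by
  refine ext_inner_right ℝ fun w => ?_
  rw [inner_gradient_snd hS]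
  simp

end PartialGradient

/-- Lemma 3.2.2 (Hamilton–Jacobi equation in the explicit Weinstein chart of `ℝ²ⁿ`):
the isotopy generated by a time-dependent generating function `S` is the Hamiltonian
flow of `H(t,ξ,η) = ∂ₜS(t, x, η)` where `x = X(t,ξ,η)` is determined by
`ξ = x + ∇_η S(t,x,η)`. -/
theorem hamilton_jacobi_generating_function
    (n : ℕ) (hn : 1 ≤ n)
    (S : ℝ × (EuclideanSpace ℝ (Fin n) × EuclideanSpace ℝ (Fin n)) → ℝ)
    (hS : ContDiff ℝ 2 S)
    (X : ℝ × (EuclideanSpace ℝ (Fin n) × EuclideanSpace ℝ (Fin n)) →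
         EuclideanSpace ℝ (Fin n))
    (hX : Differentiable ℝ X)
    (hXeq : ∀ (t : ℝ) (ξ η : EuclideanSpace ℝ (Fin n)),
      ξ = X (t, ξ, η) + gradient (fun η' => S (t, X (t, ξ, η), η')) η)
    (H : ℝ × (EuclideanSpace ℝ (Fin n) × EuclideanSpace ℝ (Fin n)) → ℝ)
    (hH : ∀ (t : ℝ) (ξ η : EuclideanSpace ℝ (Fin n)),
      H (t, ξ, η) = deriv (fun s => S (s, X (t, ξ, η), η)) t)
    (x₀ y₀ : EuclideanSpace ℝ (Fin n))
    (eta : ℝ → EuclideanSpace ℝ (Fin n)) (heta : Differentiable ℝ eta)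
    (hy₀ : ∀ t : ℝ, y₀ = eta t + gradient (fun x' => S (t, x', eta t)) x₀)
    (xi : ℝ → EuclideanSpace ℝ (Fin n))
    (hxi : ∀ t : ℝ, xi t = x₀ + gradient (fun η' => S (t, x₀, η')) (eta t))
    (hXfix : ∀ t : ℝ, X (t, xi t, eta t) = x₀) :
    ∀ t : ℝ,
      HasDerivAt xi (gradient (fun η' => H (t, xi t, η')) (eta t)) t ∧
      HasDerivAt eta (-gradient (fun ξ' => H (t, ξ', eta t)) (xi t)) t := by
  have hS1 : Differentiable ℝ S := hS.differentiable (by norm_num)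
  have hS2 : Differentiable ℝ (fderiv ℝ S) :=
    (hS.fderiv_right (m := 1) (by norm_num)).differentiable (by norm_num)
  intro t
  set e' := deriv eta t
  have hE : HasDerivAt eta e' t := (heta t).hasDerivAt
  set B := fderiv ℝ (fderiv ℝ S) (t, x₀, eta t)
  have hBd : HasFDerivAt (fderiv ℝ S) B (t, x₀, eta t) := (hS2 _).hasFDerivAt
  have hsymm : ∀ u v, B u v = B v u := fun u v =>
    (hS.contDiffAt.isSymmSndFDerivAt (by simp)).eq u v
  have hq : HasDerivAt (fun s => (s, x₀, eta s)) (1, 0, e') t :=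
    (hasDerivAt_id t).prodMk ((hasDerivAt_const t x₀).prodMk hE)
  have hBq : HasDerivAt (fun s => fderiv ℝ S (s, x₀, eta s)) (B (1, 0, e')) t :=
    HasFDerivAt.comp_hasDerivAt t (f := fun s => (s, x₀, eta s)) hBd hq
  have hBqv : ∀ v, HasDerivAt (fun s => fderiv ℝ S (s, x₀, eta s) v) (B (1, 0, e') v) t :=
    fun v => by simpa using hBq.clm_apply (hasDerivAt_const t v)
  -- differentiating the equation for `y₀` along the curve
  have hy : ∀ v, ⟪e', v⟫_ℝ + B (1, 0, e') (0, v, 0) = 0 := by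
    intro v
    have h1 : HasDerivAt (fun s => ⟪eta s, v⟫_ℝ + fderiv ℝ S (s, x₀, eta s) (0, v, 0))
        (⟪e', v⟫_ℝ + B (1, 0, e') (0, v, 0)) t := by
      simpa using (hE.inner ℝ (hasDerivAt_const t v)).fun_add (hBqv (0, v, 0))
    refine h1.unique ((hasDerivAt_const t ⟪y₀, v⟫_ℝ).congr_of_eventuallyEq (.of_forall fun s => ?_))
    dsimp only
    rw [← inner_gradient_fst hS1, ← inner_add_left, ← hy₀ s]
  -- differentiating the definition of `xi`
  have hxid : DifferentiableAt ℝ xi t := by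
    rw [show xi = fun s => x₀ + gradient (fun η' => S (s, x₀, η')) (eta s) from funext hxi]
    simp only [gradient_snd_eq hS1]
    exact ((InnerProductSpace.toDual ℝ _).symm.toContinuousLinearEquiv.differentiableAt.comp t
      (hBq.differentiableAt.clm_comp (differentiableAt_const _))).const_add x₀
  set x' := deriv xi t
  have hXi : HasDerivAt xi x' t := hxid.hasDerivAt
  have hx : ∀ w, ⟪x', w⟫_ℝ = B (1, 0, e') (0, 0, w) := by
    intro w
    have h1 : HasDerivAt (fun s => ⟪xi s, w⟫_ℝ) ⟪x', w⟫_ℝ t := by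
      simpa using hXi.inner ℝ (hasDerivAt_const t w)
    refine h1.unique (((hBqv (0, 0, w)).const_add ⟪x₀, w⟫_ℝ).congr_of_eventuallyEq
      (.of_forall fun s => ?_))
    dsimp only
    rw [← inner_gradient_snd hS1, ← inner_add_left, ← hxi s]
  -- differentiating the equation for `X` in the variables `(ξ, η)`
  obtain ⟨Z, hZ⟩ : ∃ Z, HasFDerivAt (fun p => X (t, p)) Z (xi t, eta t) :=
    ⟨_, ((hX _).comp _ ((differentiableAt_const t).prodMk differentiableAt_id)).hasFDerivAt⟩
  have hr := (hasFDerivAt_const t (xi t, eta t)).prodMk (hZ.prodMk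
    (hasFDerivAt_snd (𝕜 := ℝ) (p := (xi t, eta t))))
  have hBd' : HasFDerivAt (fderiv ℝ S) B (t, X (t, xi t, eta t), eta t) := by rwa [hXfix]
  have hBr := HasFDerivAt.comp (xi t, eta t) (f := fun p => (t, X (t, p), p.2)) hBd' hr
  have hBrv := fun v => hBr.clm_apply (hasFDerivAt_const v (xi t, eta t))
  have hz : ∀ a b w, ⟪a, w⟫_ℝ = ⟪Z (a, b), w⟫_ℝ + B (0, Z (a, b), b) (0, 0, w) := by
    intro a b w
    have h1 := (hasFDerivAt_fst (𝕜 := ℝ) (p := (xi t, eta t))).inner ℝ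
      (hasFDerivAt_const w (xi t, eta t))
    have h2 := (hZ.inner ℝ (hasFDerivAt_const w (xi t, eta t))).add (hBrv (0, 0, w))
    have h3 := h1.unique (h2.congr_of_eventuallyEq (.of_forall fun p => by
      obtain ⟨ξ, η⟩ := p
      simp only [Pi.add_apply, Function.comp_apply]
      rw [← inner_gradient_snd hS1, ← inner_add_left, ← hXeq t ξ η]))
    simpa using DFunLike.congr_fun h3 (a, b)
  have hHfun : (fun p => H (t, p)) = fun p => fderiv ℝ S (t, X (t, p), p.2) (1, 0, 0) := by
    funext ⟨ξ, η⟩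
    rw [hH, deriv_time_eq hS1]
  obtain ⟨L, hL, hLv⟩ : ∃ L, HasFDerivAt (fun p => H (t, p)) L (xi t, eta t) ∧
      ∀ a b, L (a, b) = ⟪x', b⟫_ℝ - ⟪e', a⟫_ℝ := by
    rw [hHfun]
    refine ⟨_, hBrv (1, 0, 0), fun a b => ?_⟩
    have hsplit : ∀ (s : ℝ) (u v : EuclideanSpace ℝ (Fin n)) c,
        B (s, u, v) c = B (s, 0, 0) c + B (0, u, 0) c + B (0, 0, v) c := by
      intro s u v c
      simp [← add_apply, ← map_add]
    have hLab : B (0, Z (a, b), b) (1, 0, 0) = ⟪x', b⟫_ℝ - ⟪e', a⟫_ℝ := by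
      have h1 := hy (Z (a, b))
      have h2 := hz a b e'
      have h3 := hx b
      rw [hsplit] at h1 h2 h3 ⊢
      rw [real_inner_comm e' a] at h2
      rw [real_inner_comm (Z (a, b)) e'] at h1
      rw [hsymm (0, Z (a, b), 0) (1, 0, 0), hsymm (0, 0, b) (1, 0, 0)]
      rw [hsymm (0, Z (a, b), 0) (0, 0, e'), hsymm (0, 0, b) (0, 0, e')] at h2
      have h0 : B (0, 0, 0) = 0 := map_zero B
      simp only [h0, zero_apply] at h1 h2 h3 ⊢
      linarith
    simpa using hLab
  have hgη : gradient (fun η' => H (t, xi t, η')) (eta t) = x' := by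
    refine gradient_eq_of_hasFDerivAt (HasFDerivAt.comp (eta t) (f := fun η' => (xi t, η')) hL
      ((hasFDerivAt_const _ _).prodMk (hasFDerivAt_id _))) fun v => ?_
    simp [hLv]
  have hgξ : gradient (fun ξ' => H (t, ξ', eta t)) (xi t) = -e' := by
    refine gradient_eq_of_hasFDerivAt (HasFDerivAt.comp (xi t) (f := fun ξ' => (ξ', eta t)) hL
      ((hasFDerivAt_id _).prodMk (hasFDerivAt_const _ _))) fun v => ?_
    simp [hLv]
  rw [hgη, hgξ, neg_neg]
  exact ⟨hXi, hE⟩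
end
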